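/- Let S be a cancellative, right amenable semigroup containing no free subsemigroup on two generators. Then every subsemigroup of S is right amenable. -/

import Mathlib

/-- A semigroup is right amenable if it carries a finitely additive probability measure on all
subsets which is invariant under right division: `μ(Ta⁻¹) = μ(T)` where `Ta⁻¹ = {s : sa ∈ T}`. -/
def RightAmenable (S : Type*) [Mul S] : Prop :=
  ∃ μ : Set S → ℝ, μ Set.univ = 1 ∧ (∀ T : Set S, 0 ≤ μ T) ∧
    (∀ T₁ T₂ : Set S, Disjoint T₁ T₂ → μ (T₁ ∪ T₂) = μ T₁ + μ T₂) ∧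
    (∀ (a : S) (T : Set S), μ {s | s * a ∈ T} = μ T)

/-- A semigroup `S` contains a free subsemigroup of rank two if there are `u, v ∈ S` such that
distinct words in `u, v` represent distinct elements. -/
def HasFreeSubsemigroupRankTwo (S : Type*) [Semigroup S] : Prop :=
  ∃ u v : S, Function.Injective
    ⇑(FreeSemigroup.lift (fun b : Bool => if b then v else u) : FreeSemigroup Bool →ₙ* S)

namespace FreeSemigroup

variable {α : Type*}

/-- Reversal of words, as a homomorphism to the opposite semigroup. -/
def reverseHom : FreeSemigroup α →ₙ* (FreeSemigroup α)ᵐᵒᵖ :=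
  lift fun x => MulOpposite.op (of x)

theorem reverseHom_reverseHom (w : FreeSemigroup α) :
    (reverseHom (reverseHom w).unop).unop = w := by
  induction w using FreeSemigroup.recOnMul with
  | ih1 x => simp [reverseHom]
  | ih2 x y hx hy => simp only [map_mul, MulOpposite.unop_mul, hx, hy]

theorem lift_op_eq {M : Type*} [Semigroup M] (f : α → M) (g : α → Mᵐᵒᵖ)
    (hg : ∀ x, g x = MulOpposite.op (f x)) (w : FreeSemigroup α) :
    lift g w = MulOpposite.op (lift f (reverseHom w).unop) := by
  induction w using FreeSemigroup.recOnMul with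
  | ih1 x => simp [reverseHom, hg]
  | ih2 x y hx hy => simp only [map_mul, MulOpposite.unop_mul, hx, hy, MulOpposite.op_mul]

theorem exists_lift_mul_eq {M : Type*} [Semigroup M] (f : α → M) (w : FreeSemigroup α) :
    ∃ x, ∀ z, ∃ r, lift f w * z = f x * r := by
  induction w using FreeSemigroup.recOnMul with
  | ih1 x => exact ⟨x, fun z => ⟨z, by simp⟩⟩
  | ih2 x y _ _ => exact ⟨x, fun z => ⟨lift f y * z, by simp [mul_assoc]⟩⟩

end FreeSemigroup

theorem HasFreeSubsemigroupRankTwo.of_op {M : Type*} [Semigroup M]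
    (h : HasFreeSubsemigroupRankTwo Mᵐᵒᵖ) : HasFreeSubsemigroupRankTwo M := by
  obtain ⟨u, v, h⟩ := h
  refine ⟨u.unop, v.unop, fun w₁ w₂ hw => ?_⟩
  have key := FreeSemigroup.lift_op_eq (fun b : Bool => if b then v.unop else u.unop)
    (fun b : Bool => if b then v else u) (by intro b; cases b <;> simp)
  have hr : (FreeSemigroup.reverseHom w₁).unop = (FreeSemigroup.reverseHom w₂).unop := by
    apply h
    rw [key, key, FreeSemigroup.reverseHom_reverseHom, FreeSemigroup.reverseHom_reverseHom, hw]
  rw [← FreeSemigroup.reverseHom_reverseHom w₁, hr, FreeSemigroup.reverseHom_reverseHom]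

theorem HasFreeSubsemigroupRankTwo.of_injective {M N : Type*} [Semigroup M] [Semigroup N]
    (f : M →ₙ* N) (hf : Function.Injective f) (h : HasFreeSubsemigroupRankTwo M) :
    HasFreeSubsemigroupRankTwo N := by
  obtain ⟨u, v, h⟩ := h
  refine ⟨f u, f v, ?_⟩
  have key : FreeSemigroup.lift (fun b : Bool => if b then f v else f u) =
      f.comp (FreeSemigroup.lift (fun b : Bool => if b then v else u)) := by
    ext b
    cases b <;> simp
  rw [key]
  exact hf.comp h

/-- In a left cancellative semigroup without free subsemigroups of rank two, any two principal
right ideals intersect. -/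
theorem exists_mul_eq_mul_of_not_hasFree {M : Type*} [Semigroup M] [IsLeftCancelMul M]
    (hfree : ¬ HasFreeSubsemigroupRankTwo M) (a b : M) : ∃ p q, a * p = b * q := by
  by_contra! hab
  refine hfree ⟨a, b, ?_⟩
  set f : Bool → M := fun c => if c then b else a
  have hf : ∀ x y p q, f x * p = f y * q → x = y := by
    intro x y p q h
    cases x <;> cases y <;> simp only [f, Bool.false_eq_true, if_true, if_false] at h
    · rfl
    · exact (hab _ _ h).elim
    · exact (hab _ _ h.symm).elim
    · rfl
  have hne : ∀ x w, f x ≠ f x * FreeSemigroup.lift f w := by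
    intro x w h
    obtain ⟨d, hd⟩ := FreeSemigroup.exists_lift_mul_eq f w
    obtain ⟨r, hr⟩ := hd (f (!d) * f (!d))
    have h1 : f x * (f (!d) * f (!d)) = f x * (f d * r) := by
      rw [← hr, ← mul_assoc (f x) (FreeSemigroup.lift f w), ← h]
    have h2 := hf _ _ _ _ (mul_left_cancel h1)
    cases d <;> simp at h2
  intro w₁
  induction w₁ using FreeSemigroup.recOnMul with
  | ih1 x =>
    intro w₂ h
    induction w₂ using FreeSemigroup.recOnMul with
    | ih1 y =>
      simp only [FreeSemigroup.lift_of] at h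
      rw [hf x y a a (by rw [h])]
    | ih2 y w _ _ =>
      simp only [map_mul, FreeSemigroup.lift_of] at h
      obtain rfl : x = y := hf x y a (FreeSemigroup.lift f w * a) (by rw [← mul_assoc, ← h])
      exact (hne _ _ h).elim
  | ih2 x w _ ih =>
    intro w₂ h
    induction w₂ using FreeSemigroup.recOnMul with
    | ih1 y =>
      simp only [map_mul, FreeSemigroup.lift_of] at h
      obtain rfl : x = y := hf x y (FreeSemigroup.lift f w * a) a (by rw [← mul_assoc, h])
      exact (hne _ _ h.symm).elim
    | ih2 y w' _ _ =>
      simp only [map_mul, FreeSemigroup.lift_of] at h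
      obtain rfl : x = y := hf _ _ _ _ h
      rw [ih (mul_left_cancel h)]

/-- A reversible subsemigroup of a cancellative right amenable semigroup is right amenable. -/
theorem RightAmenable.subsemigroup_of_reversible {S : Type*} [Semigroup S] [IsCancelMul S]
    (hS : RightAmenable S) (T : Subsemigroup S) [Nonempty T]
    (hR : ∀ a b : T, ∃ p q, a * p = b * q) (hL : ∀ a b : T, ∃ p q, p * a = q * b) :
    RightAmenable T := by
  obtain ⟨μ, hμ1, hμ0, hμa, hμi⟩ := hS
  -- the partition of `S` into traces of left cosets of the group of fractions of `T`
  let E : Setoid S :=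
    { r := fun s s' => ∃ t t' : T, s * t = s' * t'
      iseqv :=
        { refl := fun s => ⟨Classical.arbitrary T, Classical.arbitrary T, rfl⟩
          symm := fun ⟨t, t', h⟩ => ⟨t', t, h.symm⟩
          trans := by
            rintro x y z ⟨t, t', h⟩ ⟨u, u', h'⟩
            obtain ⟨p, q, hpq⟩ := hR t' u
            have hpq' : (t' * p : S) = u * q := congrArg Subtype.val hpq
            refine ⟨t * p, u' * q, ?_⟩
            push_cast
            rw [← mul_assoc, h, mul_assoc, hpq', ← mul_assoc, h', mul_assoc] } }
  let c : S → S := fun s => (Quotient.mk E s).out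
  have hc : ∀ s, ∃ t t' : T, s * t = c s * t' := fun s => E.symm (Quotient.mk_out (s := E) s)
  have hcmul : ∀ (s : S) (b : T), c (s * b) = c s := by
    intro s b
    have : Quotient.mk E (s * b) = Quotient.mk E s :=
      Quotient.sound ⟨b, b * b, by push_cast; rw [mul_assoc]⟩
    simp only [c, this]
  -- `R s x a` says `a = x * (c s)⁻¹ * s` in the group of fractions
  let R : S → T → T → Prop := fun s x a => ∃ t t' : T, s * t = c s * t' ∧ a * t = x * t'
  have huniq : ∀ s x a a', R s x a → R s x a' → a = a' := by
    rintro s x a a' ⟨t, t', h1, h2⟩ ⟨u, u', h3, h4⟩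
    obtain ⟨p, q, hpq⟩ := hR t u
    have hpq' : (t * p : S) = u * q := congrArg Subtype.val hpq
    have h5 : t' * p = u' * q := by
      apply Subtype.ext
      push_cast
      apply mul_left_cancel (a := c s)
      rw [← mul_assoc, ← h1, ← mul_assoc, ← h3, mul_assoc, mul_assoc, hpq']
    have h6 : a * (t * p) = a' * (t * p) := by
      rw [← mul_assoc, h2, mul_assoc, h5, ← mul_assoc, ← h4, mul_assoc, hpq]
    have h7 : (a * (t * p : T) : S) = a' * (t * p : T) := congrArg Subtype.val h6
    exact Subtype.ext (mul_right_cancel h7)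
  have hmul : ∀ s x a b, R s x a → R (s * (b : T)) x (a * b) := by
    rintro s x a b ⟨t, t', h1, h2⟩
    obtain ⟨p, q, hpq⟩ := hR t b
    have hpq' : (t * p : S) = b * q := congrArg Subtype.val hpq
    refine ⟨q, t' * p, ?_, ?_⟩
    · push_cast
      rw [hcmul, mul_assoc, ← hpq', ← mul_assoc, h1, mul_assoc]
    · rw [mul_assoc, ← hpq, ← mul_assoc, h2, mul_assoc]
  let F : Filter T := ⨅ y : T, Filter.principal {x | ∃ z, x = z * y}
  have hF : F.NeBot := by
    apply Filter.iInf_neBot_of_directed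
    · intro y y'
      obtain ⟨p, q, hpq⟩ := hL y y'
      refine ⟨p * y, ?_, ?_⟩
      · simp only [ge_iff_le, Filter.le_principal_iff, Filter.mem_principal]
        rintro _ ⟨z, rfl⟩
        exact ⟨z * p, by rw [mul_assoc]⟩
      · simp only [ge_iff_le, Filter.le_principal_iff, Filter.mem_principal]
        rintro _ ⟨z, rfl⟩
        exact ⟨z * q, by rw [hpq, mul_assoc]⟩
    · intro y
      exact Filter.principal_neBot_iff.2 ⟨y * y, y, rfl⟩
  let p : Ultrafilter T := Ultrafilter.of F
  have hex : ∀ s, ∀ᶠ x in p, ∃ a, R s x a := by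
    intro s
    obtain ⟨t, t', h⟩ := hc s
    obtain ⟨y, a, hy⟩ := hL t' t
    have hle : (p : Filter T) ≤ Filter.principal {x | ∃ z, x = z * y} :=
      (Ultrafilter.of_le F).trans (iInf_le _ y)
    refine Filter.mem_of_superset (Filter.le_principal_iff.1 hle) ?_
    rintro _ ⟨z, rfl⟩
    exact ⟨z * a, t, t', h, by rw [mul_assoc, ← hy, mul_assoc]⟩
  let L : Set T → Set S := fun A => {s | ∀ᶠ x in p, ∃ a, R s x a ∧ a ∈ A}
  refine ⟨fun A => μ (L A), ?_, fun A => hμ0 _, ?_, ?_⟩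
  · have : L Set.univ = Set.univ := by
      ext s
      simpa [L] using hex s
    simp only [this, hμ1]
  · intro A B hAB
    have hU : L (A ∪ B) = L A ∪ L B := by
      ext s
      simp only [L, Set.mem_union, Set.mem_ofPred_eq, ← Ultrafilter.eventually_or, ← exists_or,
        ← and_or_left]
    have hD : Disjoint (L A) (L B) := by
      rw [Set.disjoint_left]
      intro s hA hB
      obtain ⟨x, ⟨a, ha, haA⟩, ⟨b, hb, hbB⟩⟩ := (Filter.Eventually.and hA hB).exists
      rw [huniq s x b a hb ha] at hbB
      exact Set.disjoint_left.1 hAB haA hbB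
    simp only [hU, hμa _ _ hD]
  · intro b A
    have : L {a | a * b ∈ A} = {s | s * (b : S) ∈ L A} := by
      ext s
      apply Filter.eventually_congr
      filter_upwards [hex s] with x ⟨a, ha⟩
      constructor
      · rintro ⟨a', ha', h⟩
        exact ⟨a' * b, hmul _ _ _ _ ha', h⟩
      · rintro ⟨a', ha', h⟩
        refine ⟨a, ha, ?_⟩
        rwa [huniq _ _ _ _ ha' (hmul _ _ _ b ha)] at h
    simp only [this, hμi]

/-- If `S` is a cancellative right amenable semigroup containing no free subsemigroup on two
generators, then every (nonempty) subsemigroup of `S` is right amenable. -/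
theorem rightAmenable_subsemigroup {S : Type*} [Semigroup S]
    (hlc : ∀ a b c : S, a * b = a * c → b = c) (hrc : ∀ a b c : S, b * a = c * a → b = c)
    (hfree : ¬ HasFreeSubsemigroupRankTwo S) (hS : RightAmenable S)
    (T : Subsemigroup S) (hne : (T : Set S).Nonempty) :
    RightAmenable T := by
  have : IsCancelMul S :=
    { mul_left_cancel := fun a b c h => hlc a b c h
      mul_right_cancel := fun a b c h => hrc a b c h }
  have : IsCancelMul T :=
    { mul_left_cancel := fun a b c h => Subtype.ext (hlc a b c (congrArg Subtype.val h))
      mul_right_cancel := fun a b c h => Subtype.ext (hrc a b c (congrArg Subtype.val h)) }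
  have : Nonempty T := hne.to_subtype
  have hT : ¬ HasFreeSubsemigroupRankTwo T := fun h =>
    hfree (h.of_injective (MulMemClass.subtype T) Subtype.val_injective)
  refine hS.subsemigroup_of_reversible T (exists_mul_eq_mul_of_not_hasFree hT) fun a b => ?_
  obtain ⟨p, q, h⟩ := exists_mul_eq_mul_of_not_hasFree (fun h => hT h.of_op)
    (MulOpposite.op a) (MulOpposite.op b)
  exact ⟨p.unop, q.unop, congrArg MulOpposite.unop h⟩
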